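/- arXiv:0806.4420 — 2 statements merged into one kernel-verified Lean document; each statement's English description precedes it below -/
import Mathlib

section
/- Let G = ⟨s₁,…,s_r⟩ be the free group of rank r. If (T,X,μ,α) is a Markov G-process and σ is a splitting of α, then (T,X,μ,σ) is a Markov G-process. -/
open MeasureTheory Filter
open scoped ENNReal symmDiff

namespace Bowen

noncomputable section

/-- The free group of rank `r`. -/
abbrev FG (r : ℕ) := FreeGroup (Fin r)

/-- The generating set element corresponding to `(i, b)`: `sᵢ` if `b = true`,
`sᵢ⁻¹` if `b = false`. -/
def gen {r : ℕ} (s : Fin r × Bool) : FG r :=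
  cond s.2 (FreeGroup.of s.1) (FreeGroup.of s.1)⁻¹

/-- The symmetric generating set `S = {s₁^{±1},…,s_r^{±1}}`. -/
def Sset (r : ℕ) : Set (FG r) := Set.range (gen (r := r))

/-- The ball of radius `n` about the identity in the word metric of `(G,S)`. -/
def ball (r n : ℕ) : Set (FG r) := {g | FreeGroup.norm g ≤ n}

section Partitions

variable {X : Type*} [mX : MeasurableSpace X] {K L : Type*}

/-- Shannon entropy of the countable labeled partition `p` with respect to `μ`
(in `ℝ≥0∞`, so that `H(p) < ∞` is meaningful). -/
def Hpart (μ : Measure X) (p : X → K) : ℝ≥0∞ :=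
  ∑' k : K, ENNReal.ofReal (Real.negMulLog ((μ (p ⁻¹' {k})).toReal))

/-- The atom of the partition `p` containing `x`. -/
def atomOf (p : X → K) (x : X) : Set X := p ⁻¹' {p x}

/-- Conditional Shannon entropy of `p` given the sub-σ-algebra `m`:
`H(p|m) = ∫ -log( μ(A_x | m)(x) ) dμ(x)`. -/
def HpartC (μ : Measure X) (p : X → K) (m : MeasurableSpace X) : ℝ≥0∞ :=
  ∫⁻ x, ENNReal.ofReal
    (- Real.log ((μ[(atomOf p x).indicator (fun _ => (1:ℝ)) | m]) x)) ∂μ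

/-- Join of two labeled partitions. -/
def pjoin (p : X → K) (q : X → L) : X → K × L := fun x => (p x, q x)

/-- Pullback partition `T_g^{-1} p`. -/
def pull {r : ℕ} (T : FG r → X → X) (g : FG r) (p : X → K) : X → K :=
  fun x => p (T g x)

/-- The join `⋁_{q ∈ Q} T_q^{-1} p` over a set `Q ⊆ G`. -/
def powS {r : ℕ} (T : FG r → X → X) (p : X → K) (Q : Set (FG r)) : X → (Q → K) :=
  fun x q => p (T (q : FG r) x)

/-- The join `p^n = ⋁_{g ∈ B(e,n)} T_g^{-1} p`. -/
def pow {r : ℕ} (T : FG r → X → X) (p : X → K) (n : ℕ) : X → (ball r n → K) :=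
  powS T p (ball r n)

/-- The σ-algebra generated by the partition `p`. -/
def sAlg (p : X → K) : MeasurableSpace X := MeasurableSpace.comap p ⊤

/-- The smallest `G`-invariant σ-algebra containing the partition `p`. -/
def sAlgG {r : ℕ} (T : FG r → X → X) (p : X → K) : MeasurableSpace X :=
  ⨆ g : FG r, sAlg (pull T g p)

/-- The σ-algebra `⋁_{f ∈ Q} T_f^{-1} p` for a (possibly infinite) `Q ⊆ G`. -/
def sAlgSet {r : ℕ} (T : FG r → X → X) (p : X → K) (Q : Set (FG r)) :
    MeasurableSpace X :=
  ⨆ f ∈ Q, sAlg (pull T f p)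

/-- `F(T,α) = (1−2r)H(α) + ∑ᵢ H(α ∨ T_{sᵢ}^{-1}α)`. -/
def FF {r : ℕ} (T : FG r → X → X) (μ : Measure X) (p : X → K) : ℝ :=
  (1 - 2 * (r : ℝ)) * (Hpart μ p).toReal
    + ∑ i : Fin r, (Hpart μ (pjoin p (pull T (FreeGroup.of i) p))).toReal

/-- `f(T,α) = inf_{n>0} F(T,α^n)`, as an extended real. -/
def littleF {r : ℕ} (T : FG r → X → X) (μ : Measure X) (p : X → K) : EReal :=
  ⨅ n : ℕ, ((FF T μ (pow T p (n + 1)) : ℝ) : EReal)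

/-- Conditional version `F(T,α|𝓕) = (1−2r)H(α|𝓕) + ∑ᵢ H(α ∨ T_{sᵢ}^{-1}α|𝓕)`. -/
def FFc {r : ℕ} (T : FG r → X → X) (μ : Measure X) (m : MeasurableSpace X)
    (p : X → K) : ℝ :=
  (1 - 2 * (r : ℝ)) * (HpartC (mX := mX) μ p m).toReal
    + ∑ i : Fin r, (HpartC (mX := mX) μ (pjoin p (pull T (FreeGroup.of i) p)) m).toReal

/-- Conditional `f(T,α|𝓕) = inf_{n>0} F(T,α^n|𝓕)`. -/
def littleFc {r : ℕ} (T : FG r → X → X) (μ : Measure X) (m : MeasurableSpace X)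
    (p : X → K) : EReal :=
  ⨅ n : ℕ, ((FFc (mX := mX) T μ m (pow T p (n + 1)) : ℝ) : EReal)

/-- The mean entropy `h(T_s, α) = lim_n H(⋁_{i=0}^n T_s^{-i}α)/(n+1)`; since the
sequence is subadditive the limit equals the infimum, which we take as the
definition. -/
def hrate {r : ℕ} (T : FG r → X → X) (μ : Measure X) (s : FG r) (p : X → K) : ℝ :=
  ⨅ n : ℕ, (Hpart μ (fun x (i : Fin (n + 1)) => p (T (s ^ (i : ℕ)) x))).toReal / (n + 1)

/-- Conditional mean entropy `h(T_s, α|𝓕) = lim_n H(⋁_{i=0}^n T_s^{-i}α | 𝓕)/(n+1)`;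
for an invariant `𝓕` the sequence is subadditive so the limit equals the infimum. -/
def hrateC {r : ℕ} (T : FG r → X → X) (μ : Measure X) (m : MeasurableSpace X)
    (s : FG r) (p : X → K) : ℝ :=
  ⨅ n : ℕ, (HpartC (mX := mX) μ (fun x (i : Fin (n + 1)) => p (T (s ^ (i : ℕ)) x)) m).toReal / (n + 1)

/-- `F_*(T,α) = (1−r)H(α) + ∑ᵢ h(T_{sᵢ},α)`. -/
def Fstar {r : ℕ} (T : FG r → X → X) (μ : Measure X) (p : X → K) : ℝ :=
  (1 - (r : ℝ)) * (Hpart μ p).toReal + ∑ i : Fin r, hrate T μ (FreeGroup.of i) p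

/-- `f_*(T,α) = inf_{n>0} F_*(T,α^n)`. -/
def fstar {r : ℕ} (T : FG r → X → X) (μ : Measure X) (p : X → K) : EReal :=
  ⨅ n : ℕ, ((Fstar T μ (pow T p (n + 1)) : ℝ) : EReal)

/-- `F_*(T,α|𝓕) = (1−r)H(α|𝓕) + ∑ᵢ h(T_{sᵢ},α|𝓕)`. -/
def FstarC {r : ℕ} (T : FG r → X → X) (μ : Measure X) (m : MeasurableSpace X)
    (p : X → K) : ℝ :=
  (1 - (r : ℝ)) * (HpartC (mX := mX) μ p m).toReal + ∑ i : Fin r, hrateC (mX := mX) T μ m (FreeGroup.of i) p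

/-- `f_*(T,α|𝓕) = inf_{n>0} F_*(T,α^n|𝓕)`. -/
def fstarC {r : ℕ} (T : FG r → X → X) (μ : Measure X) (m : MeasurableSpace X)
    (p : X → K) : EReal :=
  ⨅ n : ℕ, ((FstarC (mX := mX) T μ m (pow T p (n + 1)) : ℝ) : EReal)

/-- `p` refines `q`: each atom of `p` is contained, up to a `μ`-null set,
in an atom of `q`. -/
def Refines (μ : Measure X) (p : X → K) (q : X → L) : Prop :=
  ∀ k : K, ∃ l : L, μ (p ⁻¹' {k} \ q ⁻¹' {l}) = 0

/-- Two labeled partitions are equal as partitions (up to null sets). -/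
def PartEquiv (μ : Measure X) (p : X → K) (q : X → L) : Prop :=
  Refines μ p q ∧ Refines μ q p

/-- `σ` is a simple splitting of `p`: `σ = p ∨ T_s^{-1}β` for some `s ∈ S` and
some coarsening `β` of `p`. -/
def SimpleSplit {r : ℕ} (μ : Measure X) (T : FG r → X → X) (p σ : X → ℕ) : Prop :=
  ∃ s ∈ Sset r, ∃ β : X → ℕ, Measurable β ∧ Refines μ p β ∧
    PartEquiv μ σ (pjoin p (pull T s β))

/-- `τ` is a splitting of `p`: obtained from `p` by a finite sequence of simple
splittings (as a partition, i.e. up to relabeling and null sets). -/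
def IsSplitting {r : ℕ} (μ : Measure X) (T : FG r → X → X) (p : X → ℕ)
    (τ : X → K) : Prop :=
  ∃ σ : X → ℕ, Relation.ReflTransGen (SimpleSplit μ T) p σ ∧ PartEquiv μ σ τ

/-- A partition is generating if the smallest `G`-invariant σ-algebra containing it
is the full σ-algebra up to `μ`-null sets. -/
def Generating {r : ℕ} (T : FG r → X → X) (μ : Measure X) (p : X → K) : Prop :=
  ∀ A : Set X, MeasurableSet A →
    ∃ A' : Set X, MeasurableSet[sAlgG T p] A' ∧ μ (A ∆ A') = 0

/-- The Rohlin distance `d(α,β) = H(α|β) + H(β|α)`. -/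
def rohlinDist (μ : Measure X) (p : X → K) (q : X → L) : ℝ :=
  (HpartC μ p (sAlg q)).toReal + (HpartC μ q (sAlg p)).toReal

end Partitions

/-- Adjacency in the left Cayley graph `Γ_L`: an edge joins `a` and `sa`, `s ∈ S`. -/
def adjL {r : ℕ} (a b : FG r) : Prop := ∃ s ∈ Sset r, b = s * a

/-- `Past(g₁;g₂)`: the set of `f ∈ G` such that every path in the left Cayley
graph from `f` to `g₁` passes through `g₂`. -/
def Past {r : ℕ} (g₁ g₂ : FG r) : Set (FG r) :=
  {f | ∀ l : List (FG r), l ≠ [] → l.head? = some f → l.getLast? = some g₁ →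
        l.Chain' adjL → g₂ ∈ l}

/-- A subset `F ⊆ G` is right-connected: the subgraph of the right Cayley graph
induced on `F` is connected. -/
def RightConnected {r : ℕ} (F : Set (FG r)) : Prop :=
  ∀ g ∈ F, ∀ h ∈ F,
    Relation.ReflTransGen (fun a b => a ∈ F ∧ b ∈ F ∧ ∃ s ∈ Sset r, b = a * s) g h

/-- A subset `F ⊆ G` is left-connected: the subgraph of the left Cayley graph
induced on `F` is connected. -/
def LeftConnected {r : ℕ} (F : Set (FG r)) : Prop :=
  ∀ g ∈ F, ∀ h ∈ F,
    Relation.ReflTransGen (fun a b => a ∈ F ∧ b ∈ F ∧ ∃ s ∈ Sset r, b = s * a) g h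

section Markov

variable {X : Type*} [MeasurableSpace X] {K : Type*}

/-- A `G`-process `(T,X,μ,α)` is Markov: for every `s ∈ S`, `g ∈ G` and every atom
`A` of `α`, `μ(T_{sg}^{-1}A | ⋁_{f∈Past(sg;g)} T_f^{-1}α) = μ(T_{sg}^{-1}A | T_g^{-1}α)`
almost everywhere. -/
def IsMarkov {r : ℕ} (μ : Measure X) (T : FG r → X → X) (p : X → K) : Prop :=
  ∀ s ∈ Sset r, ∀ g : FG r, ∀ k : K,
    (μ[((pull T (s * g) p) ⁻¹' {k}).indicator (fun _ => (1:ℝ)) |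
        sAlgSet T p (Past (s * g) g)])
      =ᵐ[μ]
    (μ[((pull T (s * g) p) ⁻¹' {k}).indicator (fun _ => (1:ℝ)) |
        sAlg (pull T g p)])

end Markov


section ExtraDefs

/-- The distance `d₁` between two ordered processes:
`∑_{s∈S} ∑_{i,j} |μ(A_i ∩ T_s^{-1}A_j) − ν(B_i ∩ U_s^{-1}B_j)|`. -/
def d1 {X Y : Type*} [MeasurableSpace X] [MeasurableSpace Y] {r : ℕ}
    (T : FG r → X → X) (μ : Measure X) (α : X → ℕ)
    (U : FG r → Y → Y) (ν : Measure Y) (β : Y → ℕ) : ℝ :=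
  ∑ i : Fin r, ∑ b : Bool,
    ∑' ij : ℕ × ℕ,
      |(μ (α ⁻¹' {ij.1} ∩ pull T (gen (i, b)) α ⁻¹' {ij.2})).toReal -
        (ν (β ⁻¹' {ij.1} ∩ pull U (gen (i, b)) β ⁻¹' {ij.2})).toReal|

/-- Isomorphism of ordered processes: a measure conjugacy between conull sets
intertwining the actions and carrying the `i`-th atom to the `i`-th atom. -/
def OrderedIso {X Y : Type*} [MeasurableSpace X] [MeasurableSpace Y] {r : ℕ}
    (T : FG r → X → X) (μ : Measure X) (α : X → ℕ)
    (U : FG r → Y → Y) (ν : Measure Y) (β : Y → ℕ) : Prop :=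
  ∃ (X' : Set X) (Y' : Set Y) (φ : X → Y) (ψ : Y → X),
    MeasurableSet X' ∧ MeasurableSet Y' ∧ μ X'ᶜ = 0 ∧ ν Y'ᶜ = 0 ∧
    Measurable φ ∧ Measurable ψ ∧ Set.MapsTo φ X' Y' ∧ Set.MapsTo ψ Y' X' ∧
    (∀ x ∈ X', ψ (φ x) = x) ∧ (∀ y ∈ Y', φ (ψ y) = y) ∧
    Measure.map φ μ = ν ∧
    (∀ (g : FG r), ∀ x ∈ X', φ (T g x) = U g (φ x)) ∧
    (∀ x ∈ X', β (φ x) = α x)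

/-- A transition system for `(G,S)`: a family of `K × K` matrices indexed by the
generating set together with a row vector, written as functions. -/
structure TransSys (r : ℕ) (K : Type*) where
  P : Fin r × Bool → K → K → ℝ
  pi : K → ℝ

/-- The transition system is an invariant transition system: the `P^s` are
stochastic matrices, `π` is a probability vector which is a steady state vector
for every `P^s`, and `π_i P^{s^{-1}}_{ij} = π_j P^s_{ji}`. -/
def TransSys.IsInvariant {r : ℕ} {K : Type*} (ts : TransSys r K) : Prop :=
  (∀ s i j, 0 ≤ ts.P s i j) ∧ (∀ s i, HasSum (ts.P s i) 1) ∧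
    (∀ i, 0 ≤ ts.pi i) ∧ HasSum ts.pi 1 ∧
    (∀ s j, HasSum (fun i => ts.pi i * ts.P s i j) (ts.pi j)) ∧
    (∀ s i j, ts.pi i * ts.P (s.1, !s.2) i j = ts.pi j * ts.P s j i)

/-- The canonical (shift) action of `G` on `K^G`: `(T_g x)(f) = x(fg)`. -/
def shiftT {r : ℕ} {K : Type*} : FG r → (FG r → K) → (FG r → K) :=
  fun g x f => x (f * g)

/-- `μ` is (a measure) induced by the transition system `ts`: the time-`e`
distribution is `π` and the transition probabilities into the complement of the
past are given by the matrices `P^s`.  (Note `T_g^{-1}A_k = {x : x(g) = k}`;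
the conditional equalities `μ(A|B) = c` are recorded in the equivalent product
form `μ(A ∩ B) = c·μ(B)`.) -/
def IsInducedBy {r : ℕ} {K : Type*} [MeasurableSpace K]
    (μ : Measure (FG r → K)) (ts : TransSys r K) : Prop :=
  (∀ k : K, μ {x | x 1 = k} = ENNReal.ofReal (ts.pi k)) ∧
  ∀ (s : Fin r × Bool) (g : FG r),
    FreeGroup.norm (gen s * g) = FreeGroup.norm g + 1 →
    ∀ (n : ℕ) (fs : Fin n → FG r) (ks : Fin n → K) (k₀ k : K),
      (∀ i, fs i ∈ Past (gen s * g) g ∧ fs i ≠ g) →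
      (μ ({x | x (gen s * g) = k} ∩ ({x | x g = k₀} ∩ ⋂ i, {x | x (fs i) = ks i}))
          = ENNReal.ofReal (ts.P s k₀ k) * μ ({x | x g = k₀} ∩ ⋂ i, {x | x (fs i) = ks i})) ∧
      μ ({x | x (gen s * g) = k} ∩ {x | x g = k₀})
          = ENNReal.ofReal (ts.P s k₀ k) * μ {x | x g = k₀}

end ExtraDefs

/-! ### Combinatorics of the left Cayley graph -/

lemma getLast_step {r : ℕ} {s h : FG r} (hs : s ∈ Sset r) (hh : h ≠ 1) (hsh : s * h ≠ 1) :
    (s * h).toWord.getLast? = h.toWord.getLast? := by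
  obtain ⟨⟨i, b⟩, rfl⟩ := hs
  have hw : (gen (i, b) : FG r).toWord = [(i, b)] := by
    cases b <;> simp [gen, FreeGroup.toWord_inv, FreeGroup.invRev]
  have h1 : (gen (i, b) * h).toWord = FreeGroup.reduce ((i, b) :: h.toWord) := by
    rw [FreeGroup.toWord_mul, hw]; rfl
  have h2 : h.toWord ≠ [] := by simpa using hh
  have h3 : (gen (i, b) * h).toWord ≠ [] := by
    simpa [FreeGroup.toWord_eq_nil_iff] using hsh
  rw [FreeGroup.reduce.cons, FreeGroup.reduce_toWord] at h1
  rw [h1] at h3 ⊢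
  cases hL : h.toWord with
  | nil => exact absurd hL h2
  | cons hd tl =>
    rw [hL] at h3
    simp only at h3 ⊢
    split_ifs with hc
    · rw [if_pos hc] at h3
      cases tl with
      | nil => exact absurd rfl h3
      | cons a b => simp [List.getLast?_cons_cons]
    · simp [List.getLast?_cons_cons]

lemma path_getLast {r : ℕ} (g : FG r) : ∀ (l : List (FG r)) (a b : FG r),
    l.head? = some a → l.getLast? = some b → l.IsChain adjL → g ∉ l →
    (a * g⁻¹).toWord.getLast? = (b * g⁻¹).toWord.getLast? := by
  intro l
  induction l with
  | nil => intro a b h; simp at h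
  | cons x l ih =>
    intro a b ha hb hc hg
    simp only [List.head?_cons, Option.some.injEq] at ha
    subst ha
    cases l with
    | nil => simp at hb; rw [hb]
    | cons y l =>
      rw [List.getLast?_cons_cons] at hb
      rw [List.isChain_cons_cons] at hc
      have hgx : x ≠ g := fun h => hg (by simp [h])
      have hgl : g ∉ y :: l := fun h => hg (List.mem_cons_of_mem _ h)
      have hgy : y ≠ g := fun h => hgl (by simp [h])
      rw [← ih y b rfl hb hc.2 hgl]
      obtain ⟨s, hs, rfl⟩ := hc.1
      rw [mul_assoc]
      refine (getLast_step hs ?_ ?_).symm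
      · rwa [Ne, mul_inv_eq_one]
      · rwa [← mul_assoc, Ne, mul_inv_eq_one]

lemma tree {r : ℕ} {a b g : FG r} (ha : a ∈ Sset r) (hb : b ∈ Sset r) (l : List (FG r))
    (h1 : l.head? = some (a * g)) (h2 : l.getLast? = some (b * g)) (hc : l.IsChain adjL)
    (hg : g ∉ l) : a = b := by
  have h := path_getLast g l _ _ h1 h2 hc hg
  simp only [mul_inv_cancel_right] at h
  obtain ⟨⟨i, c⟩, rfl⟩ := ha
  obtain ⟨⟨j, d⟩, rfl⟩ := hb
  have hw : ∀ (i : Fin r) (b : Bool), (gen (i, b) : FG r).toWord = [(i, b)] := by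
    intro i b
    cases b <;> simp [gen, FreeGroup.toWord_inv, FreeGroup.invRev]
  rw [hw, hw] at h
  simp at h
  rw [h.1, h.2]

lemma inv_mem_Sset {r : ℕ} {s : FG r} (hs : s ∈ Sset r) : s⁻¹ ∈ Sset r := by
  obtain ⟨⟨i, b⟩, rfl⟩ := hs
  refine ⟨(i, !b), ?_⟩
  cases b <;> simp [gen]

lemma mem_Past_self {r : ℕ} (g₁ g : FG r) : g ∈ Past g₁ g := by
  intro l _ hl _ _
  exact List.mem_of_mem_head? hl

lemma Past_step {r : ℕ} {s t g f : FG r} (hs : s ∈ Sset r) (ht : t ∈ Sset r)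
    (hf : f ∈ Past (t * g) g) (hsf : s * f ∉ Past (t * g) g) : f = g ∧ s = t := by
  simp only [Past, Set.mem_setOf_eq, not_forall] at hsf
  obtain ⟨l, hne, hh, hl, hc, hg⟩ := hsf
  have hmem := hf (f :: l) (by simp) rfl
    (by rw [List.getLast?_cons, hl]; rfl)
    (by
      cases l with
      | nil => exact absurd rfl hne
      | cons y l =>
        simp only [List.head?_cons, Option.some.injEq] at hh
        exact List.isChain_cons_cons.2 ⟨⟨s, hs, hh⟩, hc⟩)
  have hfg : f = g := by
    rcases List.mem_cons.1 hmem with h | h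
    · exact h.symm
    · exact absurd h hg
  subst hfg
  exact ⟨rfl, tree hs ht l hh hl hc hg⟩

lemma Past_mono {r : ℕ} {s t g : FG r} (hs : s ∈ Sset r) (ht : t ∈ Sset r) (hst : s ≠ t⁻¹) :
    Past (t * g) g ⊆ Past (s * (t * g)) (t * g) := by
  intro f hf l hne hh hl hc
  by_contra hg
  have hadj : adjL (s * (t * g)) (t * g) := ⟨s⁻¹, inv_mem_Sset hs, by group⟩
  have hgl := hf (l ++ [t * g]) (by simp) (by simp [List.head?_append, hh]) (by simp)
    (List.IsChain.append hc (by simp) (by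
      intro x hx y hy
      rw [hl] at hx
      simp at hx hy
      subst hx; subst hy; exact hadj))
  have hgm : g ∈ l := by
    rcases List.mem_append.1 hgl with h | h
    · exact h
    · simp at h
      obtain ⟨⟨i, b⟩, rfl⟩ := ht
      exfalso
      cases b <;> simp [gen] at h
  obtain ⟨l₁, l₂, rfl⟩ := List.append_of_mem hgm
  refine hst (tree (a := t⁻¹) (b := s) (g := t * g) (inv_mem_Sset ht) hs (g :: l₂)
    (by simp) ?_ ?_ ?_).symm
  · rw [← hl]; simp [List.getLast?_append, List.getLast?_cons]
  · exact hc.right_of_append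
  · intro h; exact hg (List.mem_append_right _ h)

/-! ### Conditional expectations of indicators -/

section CE

variable {X : Type*} {m0 : MeasurableSpace X} {μ : Measure X} [IsProbabilityMeasure μ]

/-- Indicator function of a set. -/
def ind (A : Set X) : X → ℝ := A.indicator (fun _ => (1 : ℝ))

lemma ind_int {A : Set X} (hA : MeasurableSet[m0] A) : Integrable (ind A) μ :=
  (integrable_const (1 : ℝ)).indicator hA

lemma ind_bdd (A : Set X) (x : X) : ‖ind A x‖ ≤ 1 := by
  unfold ind
  by_cases h : x ∈ A <;> simp [h]

lemma ind_sm {m : MeasurableSpace X} {A : Set X} (hA : MeasurableSet[m] A) :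
    StronglyMeasurable[m] (ind A) :=
  StronglyMeasurable.indicator (@stronglyMeasurable_const _ _ m _ _) hA

lemma ce_bdd (m : MeasurableSpace X) (A : Set X) :
    ∀ᵐ x ∂μ, ‖(μ[ind A | m]) x‖ ≤ 1 := by
  have := ae_bdd_condExp_of_ae_bdd (m := m) (μ := μ) (R := 1) (f := ind A)
    (Filter.Eventually.of_forall fun x => by simpa using ind_bdd A x)
  simpa using this

lemma bdd_mul_ae {f g : X → ℝ} (hf : ∀ᵐ x ∂μ, ‖f x‖ ≤ 1) (hg : ∀ᵐ x ∂μ, ‖g x‖ ≤ 1) :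
    ∀ᵐ x ∂μ, ‖(f * g) x‖ ≤ 1 := by
  filter_upwards [hf, hg] with x h1 h2
  rw [Pi.mul_apply, norm_mul]
  exact mul_le_one₀ h1 (norm_nonneg _) h2

lemma pullInt {m : MeasurableSpace X} (hm : m ≤ m0) {f g : X → ℝ} (hf : StronglyMeasurable[m] f)
    (hfb : ∀ᵐ x ∂μ, ‖f x‖ ≤ 1) (hg : Integrable g μ) :
    ∫ x, (f * μ[g | m]) x ∂μ = ∫ x, (f * g) x ∂μ := by
  have hfg : Integrable (f * g) μ :=
    hg.bdd_mul (hf.mono hm).aestronglyMeasurable hfb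
  rw [← integral_condExp hm (f := f * g)]
  exact integral_congr_ae (condExp_mul_of_stronglyMeasurable_left hf hfg hg).symm

lemma setInt_eq {A : Set X} (hA : MeasurableSet[m0] A) (f : X → ℝ) :
    ∫ x in A, f x ∂μ = ∫ x, (ind A * f) x ∂μ := by
  rw [← integral_indicator hA]
  congr 1
  ext x
  by_cases h : x ∈ A <;> simp [ind, h]

lemma adj {m : MeasurableSpace X} (hm : m ≤ m0) {A D : Set X} (hA : MeasurableSet[m0] A)
    (hD : MeasurableSet[m0] D) :
    ∫ x in D, (μ[ind A | m]) x ∂μ = ∫ x in A, (μ[ind D | m]) x ∂μ := by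
  rw [setInt_eq (μ := μ) hD, setInt_eq (μ := μ) hA, mul_comm, mul_comm (ind A)]
  rw [← pullInt hm stronglyMeasurable_condExp (ce_bdd m A) (ind_int hD),
    ← pullInt hm stronglyMeasurable_condExp (ce_bdd m D) (ind_int hA), mul_comm]

lemma ce_unique {m : MeasurableSpace X} (hm : m ≤ m0) {f g : X → ℝ} (hf : Integrable f μ)
    (hg : Integrable g μ) (hgm : StronglyMeasurable[m] g)
    (h : ∀ s, MeasurableSet[m] s → ∫ x in s, g x ∂μ = ∫ x in s, f x ∂μ) :
    μ[f | m] =ᵐ[μ] g :=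
  (ae_eq_condExp_of_forall_setIntegral_eq hm hf (fun _ _ _ => hg.integrableOn)
    (fun s hs _ => h s hs) hgm.aestronglyMeasurable).symm

lemma ci_of_int {m' m : MeasurableSpace X} (hm'm : m' ≤ m) (hm : m ≤ m0) {A : Set X}
    (hA : MeasurableSet[m0] A)
    (h : ∀ D, MeasurableSet[m] D →
      ∫ x in A, (μ[ind D | m']) x ∂μ = ∫ x in A, ind D x ∂μ) :
    μ[ind A | m] =ᵐ[μ] μ[ind A | m'] := by
  refine ce_unique hm (ind_int hA) integrable_condExp (stronglyMeasurable_condExp.mono hm'm) ?_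
  intro D hD
  rw [adj (hm'm.trans hm) hA (hm D hD), h D hD, setInt_eq (μ := μ) hA, setInt_eq (μ := μ) (hm D hD), mul_comm]

lemma int_of_ci {m' m : MeasurableSpace X} (hm'm : m' ≤ m) (hm : m ≤ m0) {A : Set X}
    (hA : MeasurableSet[m0] A) (h : μ[ind A | m] =ᵐ[μ] μ[ind A | m'])
    (D : Set X) (hD : MeasurableSet[m] D) :
      ∫ x in A, (μ[ind D | m']) x ∂μ = ∫ x in A, ind D x ∂μ := by
  rw [← adj (hm'm.trans hm) hA (hm D hD), setInt_eq (μ := μ) hA, mul_comm, ← setInt_eq (μ := μ) (hm D hD),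
    ← setIntegral_condExp hm (ind_int hA) hD]
  exact integral_congr_ae (ae_restrict_of_ae h.symm)

/-- From atoms to unions of atoms. -/
lemma ci_preimage {K : Type*} [Countable K] {m' m : MeasurableSpace X} (hm'm : m' ≤ m)
    (hm : m ≤ m0) {Z : X → K} (hZ : ∀ k, MeasurableSet[m0] (Z ⁻¹' {k}))
    (h : ∀ k, μ[ind (Z ⁻¹' {k}) | m] =ᵐ[μ] μ[ind (Z ⁻¹' {k}) | m']) (E : Set K) :
    MeasurableSet[m0] (Z ⁻¹' E) ∧ μ[ind (Z ⁻¹' E) | m] =ᵐ[μ] μ[ind (Z ⁻¹' E) | m'] := by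
  have hU : Z ⁻¹' E = ⋃ k : E, Z ⁻¹' {(k : K)} := by ext x; simp
  have hdis : Pairwise (Function.onFun Disjoint fun k : E => Z ⁻¹' {(k : K)}) := by
    intro a b hab
    refine Set.disjoint_left.2 fun x hx hx' => hab (Subtype.ext ?_)
    simp at hx hx'
    rw [← hx, ← hx']
  have hmeas : MeasurableSet[m0] (Z ⁻¹' E) := by
    rw [hU]; exact MeasurableSet.iUnion fun k : E => hZ k
  refine ⟨hmeas, ci_of_int hm'm hm hmeas fun D hD => ?_⟩
  rw [hU, integral_iUnion (fun k : E => hZ k) hdis integrable_condExp.integrableOn,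
    integral_iUnion (fun k : E => hZ k) hdis (ind_int (hm D hD)).integrableOn]
  congr 1
  ext k
  exact int_of_ci hm'm hm (hZ k) (h k) D hD

lemma int_pi {m : MeasurableSpace X} (hm : m ≤ m0) (S : Set (Set X))
    (hS : m = MeasurableSpace.generateFrom S) (hpi : IsPiSystem S) (huniv : Set.univ ∈ S)
    {f g : X → ℝ} (hf : Integrable f μ) (hg : Integrable g μ)
    (h : ∀ s ∈ S, ∫ x in s, f x ∂μ = ∫ x in s, g x ∂μ) (s : Set X) (hs : MeasurableSet[m] s) :
    ∫ x in s, f x ∂μ = ∫ x in s, g x ∂μ := by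
  have h0 : ∫ x, f x ∂μ = ∫ x, g x ∂μ := by simpa using h _ huniv
  induction s, hs using MeasurableSpace.induction_on_inter hS hpi with
  | empty => simp
  | basic t ht => exact h t ht
  | compl t ht ih => rw [setIntegral_compl (hm t ht) hf, setIntegral_compl (hm t ht) hg, ih, h0]
  | iUnion F hd hF ih =>
    rw [integral_iUnion (fun i => hm _ (hF i)) hd hf.integrableOn,
      integral_iUnion (fun i => hm _ (hF i)) hd hg.integrableOn]
    congr 1
    ext i
    exact ih i

lemma sup_pi (m₁ m₂ : MeasurableSpace X) :
    m₁ ⊔ m₂ = MeasurableSpace.generateFrom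
      {s | ∃ a b, MeasurableSet[m₁] a ∧ MeasurableSet[m₂] b ∧ s = a ∩ b} := by
  apply le_antisymm
  · refine sup_le ?_ ?_
    · intro a ha
      exact MeasurableSpace.measurableSet_generateFrom
        ⟨a, Set.univ, ha, @MeasurableSet.univ _ m₂, by simp⟩
    · intro a ha
      exact MeasurableSpace.measurableSet_generateFrom
        ⟨Set.univ, a, @MeasurableSet.univ _ m₁, ha, by simp⟩
  · refine MeasurableSpace.generateFrom_le ?_
    rintro s ⟨a, b, ha, hb, rfl⟩
    exact @MeasurableSet.inter _ (m₁ ⊔ m₂) _ _ ((le_sup_left : m₁ ≤ m₁ ⊔ m₂) a ha)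
      ((le_sup_right : m₂ ≤ m₁ ⊔ m₂) b hb)

lemma sup_pi_isPi (m₁ m₂ : MeasurableSpace X) :
    IsPiSystem {s | ∃ a b, MeasurableSet[m₁] a ∧ MeasurableSet[m₂] b ∧ s = a ∩ b} := by
  rintro s ⟨a, b, ha, hb, rfl⟩ t ⟨c, d, hc, hd, rfl⟩ _
  exact ⟨a ∩ c, b ∩ d, @MeasurableSet.inter _ m₁ _ _ ha hc, @MeasurableSet.inter _ m₂ _ _ hb hd,
    by ext x; simp; tauto⟩

/-- Weak union for conditional independence. -/
lemma weak_union {m' P Q C : MeasurableSpace X} (hP : P ≤ m0) (hQ : Q ≤ m0) (hmP : m' ≤ P)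
    (hmQ : m' ≤ Q) (hCQ : C ≤ Q)
    (h : ∀ A, MeasurableSet[Q] A → μ[ind A | P] =ᵐ[μ] μ[ind A | m'])
    (A : Set X) (hA : MeasurableSet[Q] A) :
    μ[ind A | P ⊔ C] =ᵐ[μ] μ[ind A | m' ⊔ C] := by
  have hsym : ∀ D, MeasurableSet[P] D → μ[ind D | Q] =ᵐ[μ] μ[ind D | m'] := by
    intro D hD
    refine ci_of_int hmQ hQ (hP D hD) fun B hB => ?_
    rw [← adj (hmP.trans hP) (hP D hD) (hQ B hB),
      int_of_ci hmP hP (hQ B hB) (h B hB) D hD, setInt_eq (μ := μ) (hQ B hB), setInt_eq (μ := μ) (hP D hD), mul_comm]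
  have hmC : m' ⊔ C ≤ Q := sup_le hmQ hCQ
  have hPC : P ⊔ C ≤ m0 := sup_le hP (hCQ.trans hQ)
  refine ce_unique hPC (ind_int (hQ A hA)) integrable_condExp
    (stronglyMeasurable_condExp.mono (sup_le_sup_right hmP C)) ?_
  refine int_pi hPC _ (sup_pi P C) (sup_pi_isPi P C)
    ⟨Set.univ, Set.univ, @MeasurableSet.univ _ P, @MeasurableSet.univ _ C, by simp⟩
    integrable_condExp (ind_int (hQ A hA)) ?_
  rintro s ⟨D, c, hD, hc, rfl⟩
  have hDc : MeasurableSet[m0] (D ∩ c) := @MeasurableSet.inter _ m0 _ _ (hP D hD) (hQ c (hCQ c hc))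
  have hind : ind (D ∩ c) = ind D * ind c := by
    ext x
    by_cases h1 : x ∈ D <;> by_cases h2 : x ∈ c <;> simp [ind, h1, h2]
  have hcb : ∀ᵐ x ∂μ, ‖ind c x‖ ≤ 1 := Filter.Eventually.of_forall (ind_bdd c)
  have hAb : ∀ᵐ x ∂μ, ‖ind A x‖ ≤ 1 := Filter.Eventually.of_forall (ind_bdd A)
  set f := μ[ind A | m' ⊔ C] with hfdef
  have hfm : StronglyMeasurable[m' ⊔ C] f := stronglyMeasurable_condExp
  have hcf : StronglyMeasurable[Q] (ind c * f) :=
    StronglyMeasurable.mul (ind_sm (hCQ c hc)) (hfm.mono hmC)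
  have hcA : StronglyMeasurable[Q] (ind c * ind A) :=
    StronglyMeasurable.mul (ind_sm (hCQ c hc)) (ind_sm hA)
  have hch : StronglyMeasurable[m' ⊔ C] (ind c * μ[ind D | m']) :=
    StronglyMeasurable.mul (ind_sm ((le_sup_right : C ≤ m' ⊔ C) c hc))
      (stronglyMeasurable_condExp.mono le_sup_left)
  rw [setInt_eq (μ := μ) hDc, setInt_eq (μ := μ) hDc, hind]
  calc ∫ x, (ind D * ind c * f) x ∂μ
      = ∫ x, ((ind c * f) * ind D) x ∂μ := by congr 1; ext x; simp only [Pi.mul_apply]; ring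
    _ = ∫ x, ((ind c * f) * μ[ind D | Q]) x ∂μ :=
        (pullInt hQ hcf (bdd_mul_ae hcb (ce_bdd _ A)) (ind_int (hP D hD))).symm
    _ = ∫ x, ((ind c * f) * μ[ind D | m']) x ∂μ :=
        integral_congr_ae ((Filter.EventuallyEq.refl _ _).mul (hsym D hD))
    _ = ∫ x, ((ind c * μ[ind D | m']) * f) x ∂μ := by congr 1; ext x; simp only [Pi.mul_apply]; ring
    _ = ∫ x, ((ind c * μ[ind D | m']) * ind A) x ∂μ :=
        pullInt (hmC.trans hQ) hch (bdd_mul_ae hcb (ce_bdd _ D)) (ind_int (hQ A hA))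
    _ = ∫ x, ((ind c * ind A) * μ[ind D | m']) x ∂μ := by congr 1; ext x; simp only [Pi.mul_apply]; ring
    _ = ∫ x, ((ind c * ind A) * μ[ind D | Q]) x ∂μ :=
        integral_congr_ae ((Filter.EventuallyEq.refl _ _).mul (hsym D hD).symm)
    _ = ∫ x, ((ind c * ind A) * ind D) x ∂μ :=
        pullInt hQ hcA (bdd_mul_ae hcb hAb) (ind_int (hP D hD))
    _ = ∫ x, (ind D * ind c * ind A) x ∂μ := by congr 1; ext x; simp only [Pi.mul_apply]; ring

lemma ind_inter (A B : Set X) : ind (A ∩ B) = A.indicator (ind B) := by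
  unfold ind; rw [Set.indicator_indicator]

lemma ci_inter {m' P : MeasurableSpace X} (hmP : m' ≤ P) {A B : Set X}
    (hA : MeasurableSet[m'] A) (hB : MeasurableSet[m0] B)
    (h : μ[ind B | P] =ᵐ[μ] μ[ind B | m']) :
    μ[ind (A ∩ B) | P] =ᵐ[μ] μ[ind (A ∩ B) | m'] := by
  rw [ind_inter]
  refine (condExp_indicator (ind_int (μ := μ) hB) (hmP A hA)).trans
    (Filter.EventuallyEq.trans ?_ (condExp_indicator (ind_int (μ := μ) hB) hA).symm)
  filter_upwards [h] with x hx
  by_cases hxA : x ∈ A <;> simp [hxA, hx]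

lemma ci_chain {K : Type*} {m' P W : MeasurableSpace X} (hmP : m' ≤ P) (hPW : P ≤ W)
    (hW : W ≤ m0) (Z : X → K) (hZW : sAlg Z ≤ W) (k : K) {B : Set X} (hB : MeasurableSet[m0] B)
    (h1 : μ[ind B | W] =ᵐ[μ] μ[ind B | sAlg Z])
    (h2 : μ[ind (Z ⁻¹' {k}) | P] =ᵐ[μ] μ[ind (Z ⁻¹' {k}) | m']) :
    μ[ind (Z ⁻¹' {k} ∩ B) | P] =ᵐ[μ] μ[ind (Z ⁻¹' {k} ∩ B) | m'] := by
  have hE : MeasurableSet[sAlg Z] (Z ⁻¹' {k}) := ⟨{k}, trivial, rfl⟩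
  obtain ⟨c, hc⟩ : ∃ c : ℝ, ∀ x ∈ Z ⁻¹' {k}, (μ[ind B | sAlg Z]) x = c := by
    by_cases hne : ∃ y, Z y = k
    · obtain ⟨y, hy⟩ := hne
      refine ⟨(μ[ind B | sAlg Z]) y, fun x hx => ?_⟩
      have hmeas : Measurable[sAlg Z] (μ[ind B | sAlg Z]) := stronglyMeasurable_condExp.measurable
      obtain ⟨S, -, hS⟩ := hmeas (measurableSet_singleton ((μ[ind B | sAlg Z]) y))
      have hyS : y ∈ Z ⁻¹' S := by rw [hS]; rfl
      have hxS : x ∈ Z ⁻¹' S := by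
        have hx' : Z x = k := hx
        rw [Set.mem_preimage, hy] at hyS
        rwa [Set.mem_preimage, hx']
      rw [hS] at hxS
      exact hxS
    · exact ⟨0, fun x hx => absurd ⟨x, hx⟩ hne⟩
  have hWc : μ[ind (Z ⁻¹' {k} ∩ B) | W] =ᵐ[μ] c • ind (Z ⁻¹' {k}) := by
    rw [ind_inter]
    refine (condExp_indicator (ind_int (μ := μ) hB) (hZW _ hE)).trans ?_
    filter_upwards [h1] with x hx
    by_cases hxA : x ∈ Z ⁻¹' {k}
    · simp only [Set.indicator_of_mem hxA, hx, hc x hxA]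
      simp [ind, Set.indicator_of_mem hxA]
    · simp [ind, Set.indicator_of_notMem hxA]
  have key : ∀ m : MeasurableSpace X, m ≤ W →
      μ[ind (Z ⁻¹' {k} ∩ B) | m] =ᵐ[μ] c • μ[ind (Z ⁻¹' {k}) | m] := fun m hm =>
    (condExp_condExp_of_le hm hW).symm.trans ((condExp_congr_ae hWc).trans (condExp_smul c _ m))
  refine (key P hPW).trans (Filter.EventuallyEq.trans ?_ (key m' (hmP.trans hPW)).symm)
  filter_upwards [h2] with x hx
  simp [hx]

lemma ci_sandwich {m₁ m₂ m₃ : MeasurableSpace X} (h12 : m₁ ≤ m₂) (h23 : m₂ ≤ m₃) (h3 : m₃ ≤ m0)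
    {f : X → ℝ} (h : μ[f | m₃] =ᵐ[μ] μ[f | m₁]) :
    μ[f | m₂] =ᵐ[μ] μ[f | m₁] := by
  refine (condExp_condExp_of_le h23 h3).symm.trans ((condExp_congr_ae h).trans ?_)
  rw [condExp_of_stronglyMeasurable (h23.trans h3) (stronglyMeasurable_condExp.mono h12)
    integrable_condExp]

lemma ce_eventually_le {m₁ m₂ : MeasurableSpace X} (h12 : m₁ ≤ m₂) (h2 : m₂ ≤ m0)
    (h : m₂ ≤ eventuallyMeasurableSpace m₁ (ae μ)) {f : X → ℝ} (hf : Integrable f μ) :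
    μ[f | m₂] =ᵐ[μ] μ[f | m₁] := by
  refine ce_unique h2 hf integrable_condExp (stronglyMeasurable_condExp.mono h12) fun s hs => ?_
  obtain ⟨t, ht, hst⟩ := h s hs
  rw [setIntegral_congr_set hst, setIntegral_congr_set hst,
    setIntegral_condExp (h12.trans h2) hf ht]

/-- Conditional expectations only depend on the `σ`-algebra modulo null sets. -/
lemma ce_equiv {m₁ m₂ : MeasurableSpace X} (h1 : m₁ ≤ m0) (h2 : m₂ ≤ m0)
    (h12 : m₁ ≤ eventuallyMeasurableSpace m₂ (ae μ))
    (h21 : m₂ ≤ eventuallyMeasurableSpace m₁ (ae μ)) {f : X → ℝ} (hf : Integrable f μ) :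
    μ[f | m₁] =ᵐ[μ] μ[f | m₂] :=
  (ce_eventually_le le_sup_left (sup_le h1 h2)
    (sup_le le_eventuallyMeasurableSpace h21) hf).symm.trans
  (ce_eventually_le le_sup_right (sup_le h1 h2)
    (sup_le h12 le_eventuallyMeasurableSpace) hf)

end CE

/-! ### Markov processes and splittings -/

section Split

variable {X : Type*}

lemma sAlg_le_of_factor {K L : Type*} {a : X → K} {b : X → L} (F : L → K)
    (h : ∀ x, a x = F (b x)) : sAlg a ≤ sAlg b := by
  rintro s ⟨S, -, rfl⟩
  exact ⟨F ⁻¹' S, trivial, by ext x; simp [h]⟩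

lemma sAlg_meas {K : Type*} (a : X → K) (S : Set K) : MeasurableSet[sAlg a] (a ⁻¹' S) :=
  ⟨S, trivial, rfl⟩

variable [m0 : MeasurableSpace X] {μ : Measure X} [IsProbabilityMeasure μ]
  {r : ℕ} {T : FG r → X → X}

lemma sAlg_le_m0 {K : Type*} [Countable K] {a : X → K} (ha : ∀ k, MeasurableSet (a ⁻¹' {k})) :
    sAlg a ≤ m0 := by
  rintro s ⟨S, -, rfl⟩
  have : a ⁻¹' S = ⋃ k : S, a ⁻¹' {(k : K)} := by ext x; simp
  rw [this]
  exact MeasurableSet.iUnion fun k => ha k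

lemma sAlg_pull_le (hTm : ∀ g, Measurable (T g)) {p : X → ℕ} (hp : Measurable p) (g : FG r) :
    sAlg (pull T g p) ≤ m0 :=
  sAlg_le_m0 fun k => (hp.comp (hTm g)) (measurableSet_singleton k)

lemma sAlgSet_le (hTm : ∀ g, Measurable (T g)) {p : X → ℕ} (hp : Measurable p)
    (Q : Set (FG r)) : sAlgSet T p Q ≤ m0 :=
  iSup₂_le fun g _ => sAlg_pull_le hTm hp g

lemma sAlg_le_sAlgSet {p : X → ℕ} {Q : Set (FG r)} {g : FG r} (hg : g ∈ Q) :
    sAlg (pull T g p) ≤ sAlgSet T p Q :=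
  le_iSup₂ (f := fun g (_ : g ∈ Q) => sAlg (pull T g p)) g hg

lemma sAlgSet_mono {p : X → ℕ} {Q Q' : Set (FG r)} (h : Q ⊆ Q') :
    sAlgSet T p Q ≤ sAlgSet T p Q' :=
  iSup₂_le fun _ hg => sAlg_le_sAlgSet (h hg)

lemma markov_split (hTmul : ∀ g h : FG r, T (g * h) = T g ∘ T h)
    (hTm : ∀ g, Measurable (T g)) {p : X → ℕ} (hp : Measurable p) (hM : IsMarkov μ T p)
    {s : FG r} (hs : s ∈ Sset r) (φ : ℕ → ℕ) :
    IsMarkov μ T (fun x => Nat.pair (p x) (φ (p (T s x)))) := by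
  intro t ht g n
  set τ : X → ℕ := fun x => Nat.pair (p x) (φ (p (T s x))) with hτ
  have hτm : Measurable τ :=
    (measurable_of_countable (fun z : ℕ × ℕ => Nat.pair z.1 (φ z.2))).comp
      (hp.prodMk (hp.comp (hTm s)))
  have hpull : ∀ f x, pull T f τ x = Nat.pair (p (T f x)) (φ (p (T (s * f) x))) := by
    intro f x
    simp [pull, hτ, hTmul]
  set u := t * g with hu
  set v := s * u with hv
  set Z : X → ℕ × ℕ × ℕ := fun x => (p (T g x), p (T u x), p (T v x)) with hZ
  have hpm : ∀ f k, MeasurableSet (pull T f p ⁻¹' {k}) := fun f k =>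
    (hp.comp (hTm f)) (measurableSet_singleton k)
  have hZk : ∀ k, Z ⁻¹' {k} =
      pull T g p ⁻¹' {k.1} ∩ (pull T u p ⁻¹' {k.2.1} ∩ pull T v p ⁻¹' {k.2.2}) := by
    rintro ⟨a, b, c⟩
    ext x
    simp [hZ, pull]
  have hZm : ∀ k, MeasurableSet (Z ⁻¹' {k}) := by
    intro k
    rw [hZk]
    exact (hpm _ _).inter ((hpm _ _).inter (hpm _ _))
  have hQ : sAlg Z ≤ m0 := sAlg_le_m0 hZm
  have hP : sAlgSet T p (Past u g) ≤ m0 := sAlgSet_le hTm hp _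
  have hmP : sAlg (pull T g p) ≤ sAlgSet T p (Past u g) := sAlg_le_sAlgSet (mem_Past_self _ _)
  have hmQ : sAlg (pull T g p) ≤ sAlg Z := sAlg_le_of_factor (fun z => z.1) fun x => rfl
  -- the base conditional independence
  have hbase : ∀ k, μ[ind (Z ⁻¹' {k}) | sAlgSet T p (Past u g)]
      =ᵐ[μ] μ[ind (Z ⁻¹' {k}) | sAlg (pull T g p)] := by
    intro k
    rw [hZk]
    refine ci_inter hmP (sAlg_meas _ _) ((hpm _ _).inter (hpm _ _)) ?_
    by_cases hst : s = t⁻¹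
    · have hvg : v = g := by rw [hv, hu, hst]; group
      rw [hvg, Set.inter_comm]
      exact ci_inter hmP (sAlg_meas _ _) (hpm _ _) (hM t ht g _)
    · exact ci_chain hmP (sAlgSet_mono (Past_mono hs ht hst)) (sAlgSet_le hTm hp _) (pull T u p)
        (sAlg_le_sAlgSet (mem_Past_self _ _)) _ (hpm _ _) (hM s hs u _) (hM t ht g _)
  have hci : ∀ A, MeasurableSet[sAlg Z] A → μ[ind A | sAlgSet T p (Past u g)]
      =ᵐ[μ] μ[ind A | sAlg (pull T g p)] := by
    rintro A ⟨E, -, rfl⟩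
    exact (ci_preimage hmP hP hZm hbase E).2
  have hA : MeasurableSet[sAlg Z] (pull T u τ ⁻¹' {n}) := by
    have : sAlg (pull T u τ) ≤ sAlg Z :=
      sAlg_le_of_factor (fun z => Nat.pair z.2.1 (φ z.2.2)) fun x => hpull u x
    exact this _ (sAlg_meas _ _)
  have hfst : ∀ f, sAlg (pull T f p) ≤ sAlg (pull T f τ) := fun f =>
    sAlg_le_of_factor (fun z => z.unpair.1) fun x => by rw [hpull]; simp [pull]
  have hfin : ∀ M₁ M₃ : MeasurableSpace X, M₁ ≤ sAlg (pull T g τ) →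
      sAlgSet T τ (Past u g) ≤ M₃ → M₃ ≤ m0 →
      μ[ind (pull T u τ ⁻¹' {n}) | M₃] =ᵐ[μ] μ[ind (pull T u τ ⁻¹' {n}) | M₁] →
      μ[ind (pull T u τ ⁻¹' {n}) | sAlgSet T τ (Past u g)] =ᵐ[μ]
        μ[ind (pull T u τ ⁻¹' {n}) | sAlg (pull T g τ)] := by
    intro M₁ M₃ h1 h3 h30 h
    have hmid : sAlg (pull T g τ) ≤ sAlgSet T τ (Past u g) := sAlg_le_sAlgSet (mem_Past_self _ _)
    exact (ci_sandwich (h1.trans hmid) h3 h30 h).trans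
      (ci_sandwich h1 (hmid.trans h3) h30 h).symm
  change μ[ind (pull T u τ ⁻¹' {n}) | sAlgSet T τ (Past u g)] =ᵐ[μ]
        μ[ind (pull T u τ ⁻¹' {n}) | sAlg (pull T g τ)]
  have hjoin : ∀ (f : FG r) (M : MeasurableSpace X), sAlg (pull T f p) ≤ M →
      sAlg (fun x => φ (p (T (s * f) x))) ≤ M → sAlg (pull T f τ) ≤ M := by
    rintro f M h1 h2 B ⟨S, -, rfl⟩
    have : pull T f τ ⁻¹' S = ⋃ z : {z : ℕ × ℕ // Nat.pair z.1 z.2 ∈ S},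
        (pull T f p ⁻¹' {z.1.1} ∩ (fun x => φ (p (T (s * f) x))) ⁻¹' {z.1.2}) := by
      ext x
      simp only [Set.mem_preimage, Set.mem_iUnion, Set.mem_inter_iff, Set.mem_singleton_iff]
      constructor
      · intro hx
        exact ⟨⟨(p (T f x), φ (p (T (s * f) x))), by rw [hpull] at hx; exact hx⟩, rfl, rfl⟩
      · rintro ⟨⟨⟨a, b⟩, hz⟩, h1, h2⟩
        simp only [pull] at h1
        simp only at h2 hz
        rw [hpull, h1, h2]
        exact hz
    rw [this]
    exact @MeasurableSet.iUnion _ _ M _ _ fun z =>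
      @MeasurableSet.inter _ M _ _ (h1 _ (sAlg_meas _ _)) (h2 _ (sAlg_meas _ _))
  by_cases hst : s = t
  · set C := sAlg (fun x => φ (p (T u x))) with hC
    have hCQ : C ≤ sAlg Z := sAlg_le_of_factor (fun z => φ z.2.1) fun x => rfl
    refine hfin (sAlg (pull T g p) ⊔ C) (sAlgSet T p (Past u g) ⊔ C) ?_ ?_
      (sup_le hP (hCQ.trans hQ)) (weak_union hP hQ hmP hmQ hCQ hci _ hA)
    · refine sup_le (hfst g) (sAlg_le_of_factor (fun z => z.unpair.2) fun x => ?_)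
      rw [hpull]; simp [hst, hu]
    · refine iSup₂_le fun f hf => hjoin f _ ((sAlg_le_sAlgSet hf).trans le_sup_left) ?_
      by_cases hsf : s * f ∈ Past u g
      · refine le_trans ?_ ((sAlg_le_sAlgSet hsf).trans le_sup_left)
        exact sAlg_le_of_factor φ fun x => rfl
      · obtain ⟨rfl, -⟩ := Past_step hs ht hf hsf
        rw [hst]
        exact le_sup_right
  · refine hfin (sAlg (pull T g p)) (sAlgSet T p (Past u g)) (hfst g) ?_ hP (hci _ hA)
    refine iSup₂_le fun f hf => hjoin f _ (sAlg_le_sAlgSet hf) ?_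
    have hsf : s * f ∈ Past u g := by
      by_contra hsf
      exact hst (Past_step hs ht hf hsf).2
    refine le_trans ?_ (sAlg_le_sAlgSet hsf)
    exact sAlg_le_of_factor φ fun x => rfl

lemma refines_iff {K L : Type*} [Countable K] {p : X → K} {q : X → L} :
    Refines μ p q ↔ ∃ φ : K → L, ∀ᵐ x ∂μ, q x = φ (p x) := by
  constructor
  · intro h
    choose φ hφ using h
    refine ⟨φ, ?_⟩
    have : ∀ᵐ x ∂μ, ∀ k, x ∉ p ⁻¹' {k} \ q ⁻¹' {φ k} :=
      ae_all_iff.2 fun k => measure_eq_zero_iff_ae_notMem.1 (hφ k)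
    filter_upwards [this] with x hx
    by_contra hne
    exact hx (p x) ⟨rfl, hne⟩
  · rintro ⟨φ, hφ⟩ k
    refine ⟨φ k, measure_mono_null ?_ hφ⟩
    rintro x ⟨hx, hx'⟩ hq
    have hx1 : p x = k := hx
    exact hx' (by rw [Set.mem_preimage, hq, hx1]; rfl)

lemma sAlgSet_eventually (hTmp : ∀ g : FG r, MeasurePreserving (T g) μ μ) {p q : X → ℕ}
    (φ : ℕ → ℕ) (h : ∀ᵐ x ∂μ, q x = φ (p x)) (Q : Set (FG r)) :
    sAlgSet T q Q ≤ eventuallyMeasurableSpace (sAlgSet T p Q) (ae μ) := by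
  refine iSup₂_le fun g hg => ?_
  rintro s ⟨S, -, rfl⟩
  refine ⟨pull T g p ⁻¹' (φ ⁻¹' S), sAlg_le_sAlgSet hg _ (sAlg_meas _ _), ?_⟩
  have hg' := (hTmp g).quasiMeasurePreserving.ae h
  refine Filter.eventuallyEq_set.2 ?_
  filter_upwards [hg'] with x hx
  simp [pull, hx]

lemma sAlgSet_singleton (p : X → ℕ) (g : FG r) : sAlgSet T p {g} = sAlg (pull T g p) := by
  simp [sAlgSet]

lemma markov_congr (hTmp : ∀ g : FG r, MeasurePreserving (T g) μ μ) {p q : X → ℕ}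
    (hp : Measurable p) (hq : Measurable q) (hpq : Refines μ p q) (hqp : Refines μ q p)
    (hM : IsMarkov μ T p) : IsMarkov μ T q := by
  obtain ⟨φ, hφ⟩ := refines_iff.1 hpq
  obtain ⟨ψ, hψ⟩ := refines_iff.1 hqp
  have hTm : ∀ g, Measurable (T g) := fun g => (hTmp g).measurable
  intro s hs g k
  have hce : ∀ (Q : Set (FG r)) (f : X → ℝ), Integrable f μ →
      μ[f | sAlgSet T q Q] =ᵐ[μ] μ[f | sAlgSet T p Q] := fun Q f hf =>
    ce_equiv (sAlgSet_le hTm hq Q) (sAlgSet_le hTm hp Q) (sAlgSet_eventually hTmp φ hφ Q)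
      (sAlgSet_eventually hTmp ψ hψ Q) hf
  have hpm : ∀ f k, MeasurableSet (pull T f p ⁻¹' {k}) := fun f k =>
    (hp.comp (hTm f)) (measurableSet_singleton k)
  obtain ⟨hm, hE⟩ := ci_preimage (μ := μ)
    (sAlg_le_sAlgSet (T := T) (p := p) (mem_Past_self (s * g) g))
    (sAlgSet_le hTm hp _) (hpm (s * g)) (hM s hs g) (φ ⁻¹' {k})
  have hind : ind (pull T (s * g) q ⁻¹' {k}) =ᵐ[μ] ind (pull T (s * g) p ⁻¹' (φ ⁻¹' {k})) := by
    have hg' := (hTmp (s * g)).quasiMeasurePreserving.ae hφ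
    filter_upwards [hg'] with x hx
    simp [ind, Set.indicator, pull, hx]
  change μ[ind (pull T (s * g) q ⁻¹' {k}) | sAlgSet T q (Past (s * g) g)] =ᵐ[μ]
    μ[ind (pull T (s * g) q ⁻¹' {k}) | sAlg (pull T g q)]
  refine (condExp_congr_ae hind).trans (((hce _ _ (ind_int hm)).trans ?_).trans
    (condExp_congr_ae hind).symm)
  refine hE.trans ?_
  have := hce {g} _ (ind_int hm)
  rw [sAlgSet_singleton, sAlgSet_singleton] at this
  exact this.symm

lemma refines_trans {K L M : Type*} [Countable K] [Countable L] {p : X → K} {q : X → L}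
    {w : X → M} (h1 : Refines μ p q) (h2 : Refines μ q w) : Refines μ p w := by
  obtain ⟨a, ha⟩ := refines_iff.1 h1
  obtain ⟨b, hb⟩ := refines_iff.1 h2
  refine refines_iff.2 ⟨b ∘ a, ?_⟩
  filter_upwards [ha, hb] with x h h'
  simp [h', h]

lemma chain_markov (hTmul : ∀ g h : FG r, T (g * h) = T g ∘ T h)
    (hTmp : ∀ g : FG r, MeasurePreserving (T g) μ μ) {p : X → ℕ} (hp : Measurable p)
    (hM : IsMarkov μ T p) {σ : X → ℕ} (h : Relation.ReflTransGen (SimpleSplit μ T) p σ) :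
    ∃ σ' : X → ℕ, Measurable σ' ∧ Refines μ σ σ' ∧ Refines μ σ' σ ∧ IsMarkov μ T σ' := by
  have hTm : ∀ g, Measurable (T g) := fun g => (hTmp g).measurable
  induction h with
  | refl =>
    exact ⟨p, hp, refines_iff.2 ⟨id, by simp⟩, refines_iff.2 ⟨id, by simp⟩, hM⟩
  | @tail σ τ _ hst ih =>
    obtain ⟨σ', hσ'm, h1, h2, hM'⟩ := ih
    obtain ⟨s, hs, β, hβm, hβ, h3, h4⟩ := hst
    obtain ⟨φ, hφ⟩ := refines_iff.1 (refines_trans h2 hβ)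
    have hφs := (hTmp s).quasiMeasurePreserving.ae hφ
    obtain ⟨a, ha⟩ := refines_iff.1 h1
    obtain ⟨b, hb⟩ := refines_iff.1 h2
    refine ⟨fun x => Nat.pair (σ' x) (φ (σ' (T s x))), ?_, refines_trans h3 ?_,
      refines_trans (refines_iff.2 ⟨fun n => (b n.unpair.1, n.unpair.2), ?_⟩) h4,
      markov_split hTmul hTm hσ'm hM' hs φ⟩
    · exact (measurable_of_countable (fun z : ℕ × ℕ => Nat.pair z.1 (φ z.2))).comp
        (hσ'm.prodMk (hσ'm.comp (hTm s)))
    · refine refines_iff.2 ⟨fun z => Nat.pair (a z.1) z.2, ?_⟩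
      filter_upwards [hφs, ha] with x hx hx'
      simp [pjoin, pull, hx, hx']
    · filter_upwards [hφs, hb] with x hx hx'
      simp [pjoin, pull, hx, hx']

end Split

/-- a splitting of a Markov process is Markov. -/
theorem stmt_9 {r : ℕ} (hr : 1 ≤ r) {X : Type*} [MeasurableSpace X] [StandardBorelSpace X]
    (μ : Measure X) [IsProbabilityMeasure μ]
    (T : FG r → X → X) (hT1 : T 1 = id)
    (hTmul : ∀ g h : FG r, T (g * h) = T g ∘ T h)
    (hTmp : ∀ g : FG r, MeasurePreserving (T g) μ μ)
    (α σ : X → ℕ) (hαm : Measurable α) (hσm : Measurable σ)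
    (hmarkov : IsMarkov μ T α) (hsplit : IsSplitting μ T α σ) :
    IsMarkov μ T σ := by
  obtain ⟨σ₀, hch, h1, h2⟩ := hsplit
  obtain ⟨σ', hσ'm, h3, h4, hM'⟩ := chain_markov hTmul hTmp hαm hmarkov hch
  exact markov_congr hTmp hσ'm hσm (refines_trans h4 h1) (refines_trans h2 h3) hM'

end

end Bowen
end

section
/- Let G = ⟨s₁,…,s_r⟩ be the free group of rank r, let ({P^s}_{s∈S}, π) be an invariant transition system with state space K, and let μ be a Borel probability measure on K^G induced by this transition system. Then μ is invariant under the canonical action of G: for all g ∈ G and all Borel sets E ⊂ K^G, μ(T_g^{-1}E) = μ(E). -/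
open MeasureTheory Filter
open scoped ENNReal symmDiff

namespace Bowen

noncomputable section

section Helpers

variable {r : ℕ}

lemma gen_eq_mk (t : Fin r × Bool) : gen t = FreeGroup.mk [t] := by
  obtain ⟨i, b⟩ := t
  cases b <;> simp [gen, FreeGroup.of, FreeGroup.inv_mk, FreeGroup.invRev]

lemma gen_inv (t : Fin r × Bool) : gen (t.1, !t.2) = (gen t)⁻¹ := by
  obtain ⟨i, b⟩ := t
  cases b <;> simp [gen]

lemma toWord_gen (t : Fin r × Bool) : (gen t).toWord = [t] := by
  rw [gen_eq_mk]; simp [FreeGroup.toWord_mk, FreeGroup.reduce_singleton]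

lemma toWord_gen_mul (t : Fin r × Bool) (a : FG r) :
    (gen t * a).toWord = t :: a.toWord ∨
      a.toWord = (t.1, !t.2) :: (gen t * a).toWord := by
  have h : (gen t * a).toWord = FreeGroup.reduce (t :: a.toWord) := by
    conv_lhs => rw [← FreeGroup.mk_toWord (x := a), gen_eq_mk, FreeGroup.mul_mk]
    simp [FreeGroup.toWord_mk]
  rw [h, FreeGroup.reduce.cons, FreeGroup.reduce_toWord]
  rcases hw : a.toWord with _ | ⟨c, L⟩
  · left; rfl
  · by_cases hc : t.1 = c.1 ∧ t.2 = !c.2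
    · right
      simp only [hc, and_self, if_true]
      simp
    · left
      simp only [hc, if_false]

lemma toWord_of_norm (t : Fin r × Bool) (a : FG r)
    (h : FreeGroup.norm (gen t * a) = FreeGroup.norm a + 1) :
    (gen t * a).toWord = t :: a.toWord := by
  rcases toWord_gen_mul t a with h' | h'
  · exact h'
  · have := congrArg List.length h'
    simp only [FreeGroup.norm, List.length_cons] at *
    omega

lemma exists_decomp (f : FG r) (c : Fin r × Bool) (L : List (Fin r × Bool))
    (hf : f.toWord = c :: L) :
    f = gen c * FreeGroup.mk L ∧ (FreeGroup.mk L).toWord = L := by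
  have h1 : f = gen c * FreeGroup.mk L := by
    rw [gen_eq_mk, FreeGroup.mul_mk, ← FreeGroup.mk_toWord (x := f), hf]; rfl
  refine ⟨h1, ?_⟩
  rcases toWord_gen_mul c (FreeGroup.mk L) with h' | h'
  · rw [← h1, hf] at h'
    simpa using h'.symm
  · rw [← h1, hf] at h'
    have h2 : (FreeGroup.mk L).toWord.length ≤ L.length := FreeGroup.norm_mk_le
    rw [h'] at h2
    simp at h2

/-- Elements outside of the branch at `s g` are in the past. -/
lemma mem_past_of_not_suffix (s : Fin r × Bool) (g f : FG r)
    (hn : FreeGroup.norm (gen s * g) = FreeGroup.norm g + 1)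
    (hf : ¬ (gen s * g).toWord <:+ f.toWord) : f ∈ Past (gen s * g) g := by
  intro l
  induction l generalizing f with
  | nil => intro h; exact absurd rfl h
  | cons a l ih =>
    intro _ hh hl hc
    simp only [List.head?_cons, Option.some.injEq] at hh
    subst hh
    rcases l with _ | ⟨b, l⟩
    · simp at hl
      subst hl
      exact absurd (List.suffix_refl _) hf
    · have hc' := List.isChain_cons_cons.1 hc
      obtain ⟨⟨_, ⟨t, rfl⟩, hb⟩, hc2⟩ := hc'
      by_cases hbs : (gen s * g).toWord <:+ b.toWord
      · have hag : a = g := by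
          rw [hb] at hbs
          rcases toWord_gen_mul t a with h' | h'
          · rw [h', List.suffix_cons_iff] at hbs
            rcases hbs with h2 | h2
            · rw [toWord_of_norm s g hn] at h2
              simp only [List.cons.injEq] at h2
              exact (FreeGroup.toWord_injective h2.2).symm
            · exact absurd h2 hf
          · exfalso
            apply hf
            rw [h']
            exact hbs.trans (List.suffix_cons _ _)
        subst hag
        exact List.mem_cons_self
      · exact List.mem_cons_of_mem _
          (ih b hbs (by simp) rfl (by simpa using hl) hc2)

lemma past_mul (a b f t : FG r) (h : f ∈ Past a b) : f * t ∈ Past (a * t) (b * t) := by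
  intro l hne hh hl hc
  have := h (l.map (· * t⁻¹)) (by simpa using hne) (by simp [List.head?_map, hh])
    (by simp [List.getLast?_map, hl]) ?_
  · rw [List.mem_map] at this
    obtain ⟨y, hy, rfl⟩ := this
    simpa using hy
  · show List.IsChain _ _
    rw [List.isChain_map]
    refine List.IsChain.imp ?_ hc
    rintro x y ⟨s, hs, rfl⟩
    exact ⟨s, hs, by group⟩

lemma suffix_of_mem_past (t : Fin r × Bool) (L : List (Fin r × Bool)) :
    ∀ f : FG r, f.toWord = L → f ∈ Past 1 (gen t) → [t] <:+ f.toWord := by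
  induction L with
  | nil =>
    intro f hf hp
    have h1 : f = 1 := FreeGroup.toWord_eq_nil_iff.1 hf
    subst h1
    have := hp [1] (by simp) rfl rfl (List.isChain_singleton _)
    simp only [List.mem_singleton] at this
    have h2 := toWord_gen t
    rw [this] at h2
    simp at h2
  | cons c L ih =>
    intro f hf hp
    obtain ⟨h1, h2⟩ := exists_decomp f c L hf
    by_cases hft : f = gen t
    · rw [hft, toWord_gen]
    · have := ih (FreeGroup.mk L) h2 ?_
      · rw [hf]
        rw [h2] at this
        exact this.trans (List.suffix_cons _ _)
      · intro l hne hh hl hc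
        have := hp (f :: l) (by simp) rfl (by
          rcases l with _ | ⟨b, l⟩
          · exact absurd rfl hne
          · simpa using hl) (by
          rcases l with _ | ⟨b, l⟩
          · exact absurd rfl hne
          · simp only [List.head?_cons, Option.some.injEq] at hh
            subst hh
            refine List.isChain_cons_cons.2 ⟨⟨gen (c.1, !c.2), ⟨_, rfl⟩, ?_⟩, hc⟩
            rw [gen_inv, h1]; group)
        rcases List.mem_cons.1 this with h | h
        · exact absurd h.symm hft
        · exact h

lemma exceptional (s t : Fin r × Bool) (g : FG r)
    (hn : FreeGroup.norm (gen s * g) = FreeGroup.norm g + 1)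
    (hn' : FreeGroup.norm (gen s * (g * gen t)) ≠ FreeGroup.norm (g * gen t) + 1) :
    g = 1 ∧ t = (s.1, !s.2) := by
  have hw := (toWord_gen_mul s (g * gen t)).resolve_left (fun h => hn' (by
    simp [FreeGroup.norm, h]))
  have hg := toWord_of_norm s g hn
  have hsub : (g * gen t).toWord.Sublist (g.toWord ++ [t]) := by
    have := FreeGroup.toWord_mul_sublist g (gen t)
    rwa [toWord_gen] at this
  have h1 : FreeGroup.norm (gen s * g) ≤ FreeGroup.norm (gen s * (g * gen t)) + 1 := by
    have h := FreeGroup.norm_mul_le (gen s * (g * gen t)) (gen t)⁻¹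
    have e : gen s * (g * gen t) * (gen t)⁻¹ = gen s * g := by group
    rw [e, FreeGroup.norm_inv_eq] at h
    have : FreeGroup.norm (gen t) = 1 := by simp [FreeGroup.norm, toWord_gen]
    omega
  have hlen := congrArg List.length hw
  have hl2 := congrArg List.length hg
  simp only [FreeGroup.norm, List.length_cons] at h1 hlen hl2
  have heq : (g * gen t).toWord = g.toWord ++ [t] :=
    hsub.eq_of_length_le (by simp; omega)
  rcases hgw : g.toWord with _ | ⟨c, L⟩
  · refine ⟨FreeGroup.toWord_eq_nil_iff.1 hgw, ?_⟩
    rw [heq, hgw] at hw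
    simp at hw
    exact hw.1
  · exfalso
    rw [heq, hgw] at hw
    simp only [List.cons_append, List.cons.injEq] at hw
    have h3 := exists_decomp g c L hgw
    have h4 : gen s * g = FreeGroup.mk L := by
      rw [h3.1, hw.1, gen_inv]; group
    rw [h4, h3.2, hgw] at hg
    have := congrArg List.length hg
    simp only [List.length_cons] at this
    omega

/-! Cylinder sets -/

variable {K : Type*}

/-- Cylinder sets. -/
def cyl (F : Finset (FG r × K)) : Set (FG r → K) := {x | ∀ p ∈ F, x p.1 = p.2}

variable [MeasurableSpace K] [DiscreteMeasurableSpace K] [Countable K]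

lemma meas_pt (g : FG r) (k : K) : MeasurableSet {x : FG r → K | x g = k} :=
  (measurable_pi_apply (X := fun _ : FG r => K) g) (measurableSet_singleton k)

lemma meas_cyl (F : Finset (FG r × K)) : MeasurableSet (cyl F) := by
  have : cyl F = ⋂ p ∈ F, {x | x p.1 = p.2} := by ext x; simp [cyl]
  rw [this]
  exact Finset.measurableSet_biInter _ (fun p _ => meas_pt _ _)

lemma measure_split (m : Measure (FG r → K)) (g : FG r) (E : Set (FG r → K))
    (hE : MeasurableSet E) : m E = ∑' k : K, m ({x | x g = k} ∩ E) := by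
  have h : E = ⋃ k : K, ({x | x g = k} ∩ E) := by ext x; simp
  conv_lhs => rw [h]
  refine measure_iUnion ?_ (fun k => (meas_pt g k).inter hE)
  intro i j hij
  refine Set.disjoint_left.2 ?_
  rintro x ⟨h1, _⟩ ⟨h2, _⟩
  exact hij (h1.symm.trans h2)

open Classical in
lemma cyl_insert (g : FG r) (k : K) (F : Finset (FG r × K)) :
    cyl (insert (g, k) F) = {x | x g = k} ∩ cyl F := by
  ext x; simp [cyl]

open Classical in
lemma uniq (m1 m2 : Measure (FG r → K)) (P : Fin r × Bool → K → K → ℝ≥0∞)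
    (u : FG r) (B : Set (FG r))
    (hu : ∀ f ∈ B, FreeGroup.norm u ≤ FreeGroup.norm f)
    (hB : ∀ f ∈ B, f ≠ u → ∃ s g, g ∈ B ∧ f = gen s * g ∧
      FreeGroup.norm (gen s * g) = FreeGroup.norm g + 1)
    (h0 : ∀ k, m1 {x | x u = k} = m2 {x | x u = k})
    (h1 : ∀ s g F, g ∈ B → FreeGroup.norm (gen s * g) = FreeGroup.norm g + 1 →
      (∀ p ∈ F, p.1 ∈ Past (gen s * g) g) → ∀ k k₀,
      m1 ({x | x (gen s * g) = k} ∩ ({x | x g = k₀} ∩ cyl F)) =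
        P s k₀ k * m1 ({x | x g = k₀} ∩ cyl F))
    (h2 : ∀ s g F, g ∈ B → FreeGroup.norm (gen s * g) = FreeGroup.norm g + 1 →
      (∀ p ∈ F, p.1 ∈ Past (gen s * g) g) → ∀ k k₀,
      m2 ({x | x (gen s * g) = k} ∩ ({x | x g = k₀} ∩ cyl F)) =
        P s k₀ k * m2 ({x | x g = k₀} ∩ cyl F)) :
    ∀ (n : ℕ) (F : Finset (FG r × K)), ∑ p ∈ F, FreeGroup.norm p.1 = n →
      (∀ p ∈ F, p.1 ∈ B) → m1 (cyl F) = m2 (cyl F) := by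
  intro n
  induction n using Nat.strong_induction_on with
  | _ n ih =>
  intro F hF hFB
  by_cases hcons : ∃ p ∈ F, ∃ q ∈ F, p.1 = q.1 ∧ p.2 ≠ q.2
  · obtain ⟨p, hp, q, hq, e, hne⟩ := hcons
    have : cyl F = ∅ := by
      ext x
      simp only [cyl, Set.mem_setOf_eq, Set.mem_empty_iff_false, iff_false]
      intro h
      exact hne (by rw [← h p hp, ← h q hq, e])
    simp [this]
  push Not at hcons
  by_cases hne : (F.filter (fun p => p.1 ≠ u)).Nonempty
  · obtain ⟨⟨f, k⟩, hp, hmax⟩ := Finset.exists_max_image _ (fun p => FreeGroup.norm p.1) hne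
    rw [Finset.mem_filter] at hp
    obtain ⟨hpF, hfu⟩ := hp
    simp only at hfu hmax
    obtain ⟨s, g, hgB, rfl, hn⟩ := hB f (hFB _ hpF) hfu
    have hins : cyl F = {x | x (gen s * g) = k} ∩ cyl (F.erase (gen s * g, k)) := by
      rw [← cyl_insert, Finset.insert_erase hpF]
    have hpast : ∀ p ∈ F.erase (gen s * g, k), p.1 ∈ Past (gen s * g) g := by
      intro p hp
      rw [Finset.mem_erase] at hp
      have hpne : p.1 ≠ gen s * g := by
        intro e
        exact hp.1 (Prod.ext e (hcons _ hp.2 _ hpF e))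
      apply mem_past_of_not_suffix s g _ hn
      intro hsuf
      by_cases hpu : p.1 = u
      · rw [hpu] at hsuf hpne
        exact hpne (FreeGroup.toWord_injective
          (hsuf.eq_of_length_le (hu _ (hFB _ hpF)))).symm
      · have := hmax p (by simp [hp.2, hpu])
        exact hpne (FreeGroup.toWord_injective (hsuf.eq_of_length_le this)).symm
    have key : ∀ m : Measure (FG r → K), m (cyl F) = ∑' k₀ : K,
        m ({x | x (gen s * g) = k} ∩ ({x | x g = k₀} ∩ cyl (F.erase (gen s * g, k)))) := by
      intro m
      rw [measure_split m g _ (meas_cyl F)]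
      refine tsum_congr fun k₀ => ?_
      rw [hins]
      congr 1
      ext x; simp only [Set.mem_inter_iff]; tauto
    rw [key, key]
    refine tsum_congr fun k₀ => ?_
    rw [h1 s g _ hgB hn hpast, h2 s g _ hgB hn hpast, ← cyl_insert]
    congr 1
    refine ih _ ?_ _ rfl ?_
    · have e1 : ∑ p ∈ insert (g, k₀) (F.erase (gen s * g, k)), FreeGroup.norm p.1 ≤
          FreeGroup.norm g + ∑ p ∈ F.erase (gen s * g, k), FreeGroup.norm p.1 := by
        by_cases hm : (g, k₀) ∈ F.erase (gen s * g, k)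
        · rw [Finset.insert_eq_of_mem hm]; omega
        · rw [Finset.sum_insert hm]
      have e2 := Finset.add_sum_erase F (fun p => FreeGroup.norm p.1) hpF
      simp only at e2
      omega
    · intro p hp
      rcases Finset.mem_insert.1 hp with rfl | hp
      · exact hgB
      · exact hFB _ (Finset.mem_of_mem_erase hp)
  · rw [Finset.not_nonempty_iff_eq_empty, Finset.filter_eq_empty_iff] at hne
    push Not at hne
    rcases F.eq_empty_or_nonempty with rfl | ⟨⟨f, k⟩, hp⟩
    · rw [measure_split m1 u _ (meas_cyl _), measure_split m2 u _ (meas_cyl _)]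
      refine tsum_congr fun k => ?_
      simp [cyl, h0]
    · have hfu := hne hp
      simp only at hfu
      subst hfu
      have : cyl F = {x | x f = k} := by
        ext x
        simp only [cyl, Set.mem_setOf_eq]
        constructor
        · intro h; exact h _ hp
        · intro h q hq
          rw [hne hq, h]
          exact hcons _ hp _ hq (hne hq).symm
      rw [this, h0]

open Classical in
lemma rec_mu (ts : TransSys r K) (μ : Measure (FG r → K)) (hμ : IsInducedBy μ ts)
    (s : Fin r × Bool) (g : FG r) (F : Finset (FG r × K))
    (hn : FreeGroup.norm (gen s * g) = FreeGroup.norm g + 1)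
    (hF : ∀ p ∈ F, p.1 ∈ Past (gen s * g) g) (k k₀ : K) :
    μ ({x | x (gen s * g) = k} ∩ ({x | x g = k₀} ∩ cyl F)) =
        ENNReal.ofReal (ts.P s k₀ k) * μ ({x | x g = k₀} ∩ cyl F) := by
  by_cases hbad : ∃ p ∈ F, p.1 = g ∧ p.2 ≠ k₀
  · obtain ⟨p, hp, e, hne⟩ := hbad
    have : {x : FG r → K | x g = k₀} ∩ cyl F = ∅ := by
      apply Set.eq_empty_of_forall_notMem
      rintro x ⟨h1, h2⟩
      apply hne
      rw [← h2 p hp, e]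
      exact h1
    simp [this]
  · push Not at hbad
    let F' := F.filter (fun p => p.1 ≠ g)
    let L := F'.toList
    have := (hμ.2 s g hn L.length (fun i => (L.get i).1) (fun i => (L.get i).2) k₀ k ?_).1
    · have e : {x : FG r → K | x g = k₀} ∩ cyl F =
          {x | x g = k₀} ∩ ⋂ i : Fin L.length, {x | x (L.get i).1 = (L.get i).2} := by
        ext x
        constructor
        · rintro ⟨h1, h2⟩
          refine ⟨h1, Set.mem_iInter.2 fun i => h2 _ ?_⟩
          have : L.get i ∈ L := List.get_mem _ _
          exact (Finset.mem_filter.1 (Finset.mem_toList.1 this)).1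
        · rintro ⟨h1, h2⟩
          refine ⟨h1, fun p hp => ?_⟩
          by_cases hpg : p.1 = g
          · rw [hpg, hbad p hp hpg]; exact h1
          · have : p ∈ L := Finset.mem_toList.2 (Finset.mem_filter.2 ⟨hp, hpg⟩)
            obtain ⟨i, rfl⟩ := List.mem_iff_get.1 this
            exact Set.mem_iInter.1 h2 i
      rw [e]
      exact this
    · intro i
      have : L.get i ∈ L := List.get_mem _ _
      have h := Finset.mem_filter.1 (Finset.mem_toList.1 this)
      exact ⟨hF _ h.1, h.2⟩

lemma norm_gen_mul_one (s : Fin r × Bool) :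
    FreeGroup.norm (gen s * 1) = FreeGroup.norm (1 : FG r) + 1 := by
  simp [FreeGroup.norm, toWord_gen]

lemma pair_mu (ts : TransSys r K) (μ : Measure (FG r → K)) (hμ : IsInducedBy μ ts)
    (s : Fin r × Bool) (k k₀ : K) :
    μ ({x | x (gen s) = k} ∩ {x | x 1 = k₀}) =
      ENNReal.ofReal (ts.P s k₀ k) * ENNReal.ofReal (ts.pi k₀) := by
  have := (hμ.2 s 1 (norm_gen_mul_one s) 0 Fin.elim0 Fin.elim0 k₀ k (fun i => i.elim0)).2
  rwa [hμ.1, mul_one] at this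

lemma marg_mu (ts : TransSys r K) (hts : ts.IsInvariant) (μ : Measure (FG r → K))
    (hμ : IsInducedBy μ ts) (s : Fin r × Bool) (k : K) :
    μ {x | x (gen s) = k} = ENNReal.ofReal (ts.pi k) := by
  obtain ⟨hP, -, hpi, -, hst, -⟩ := hts
  rw [measure_split μ 1 _ (meas_pt _ _)]
  have : ∀ k₀, μ ({x | x 1 = k₀} ∩ {x | x (gen s) = k}) =
      ENNReal.ofReal (ts.pi k₀ * ts.P s k₀ k) := by
    intro k₀
    rw [Set.inter_comm, pair_mu ts μ hμ, ENNReal.ofReal_mul (hpi _), mul_comm]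
  simp_rw [this]
  rw [← ENNReal.ofReal_tsum_of_nonneg (fun i => mul_nonneg (hpi _) (hP _ _ _)) (hst s k).summable,
    (hst s k).tsum_eq]

open Classical in
lemma reverse_mu (ts : TransSys r K) (hts : ts.IsInvariant) (μ : Measure (FG r → K))
    [IsProbabilityMeasure μ]
    (hμ : IsInducedBy μ ts) (s t : Fin r × Bool) (hst : t = (s.1, !s.2)) (k k₀ : K)
    (F : Finset (FG r × K)) (hF : ∀ p ∈ F, [t] <:+ p.1.toWord) :
    μ ({x | x 1 = k} ∩ ({x | x (gen t) = k₀} ∩ cyl F)) =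
      ENNReal.ofReal (ts.P s k₀ k) * μ ({x | x (gen t) = k₀} ∩ cyl F) := by
  set A : Set (FG r → K) := {x | x 1 = k} ∩ {x | x (gen t) = k₀} with hA
  set A' : Set (FG r → K) := {x | x (gen t) = k₀} with hA'
  have mA' : MeasurableSet A' := meas_pt _ _
  have mA : MeasurableSet A := (meas_pt _ _).inter mA'
  have hmA' : μ A' = ENNReal.ofReal (ts.pi k₀) := marg_mu ts hts μ hμ t k₀
  have hmA : μ A = ENNReal.ofReal (ts.P s k₀ k) * ENNReal.ofReal (ts.pi k₀) := by
    rw [hA, Set.inter_comm, pair_mu ts μ hμ]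
    obtain ⟨hP, -, hpi, -, -, hrev⟩ := hts
    rw [← ENNReal.ofReal_mul (hP _ _ _), ← ENNReal.ofReal_mul (hP _ _ _), mul_comm, hst, hrev,
      mul_comm]
  have hApast : ∀ (a : Fin r × Bool) (g : FG r), [t] <:+ g.toWord →
      FreeGroup.norm (gen a * g) = FreeGroup.norm g + 1 →
      (1 : FG r) ∈ Past (gen a * g) g ∧ gen t ∈ Past (gen a * g) g := by
    intro a g hg hn
    have hw := toWord_of_norm a g hn
    have hl := hg.length_le
    constructor
    · apply mem_past_of_not_suffix _ _ _ hn
      intro h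
      have := h.length_le
      rw [hw] at this
      simp at this
    · apply mem_past_of_not_suffix _ _ _ hn
      intro h
      have := h.length_le
      rw [hw, toWord_gen] at this
      simp only [List.length_cons, List.length_nil] at this hl
      omega
  have main := uniq ((μ A') • μ.restrict A) ((μ A) • μ.restrict A')
    (fun s k₀ k => ENNReal.ofReal (ts.P s k₀ k)) (gen t) {f | [t] <:+ f.toWord} ?_ ?_ ?_ ?_ ?_
    _ F rfl hF
  · simp only [Measure.smul_apply, smul_eq_mul, Measure.restrict_apply (meas_cyl F)] at main
    rw [hmA, mul_comm _ (ENNReal.ofReal (ts.pi k₀)), mul_assoc, ← hmA'] at main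
    have e1 : {x : FG r → K | x 1 = k} ∩ (A' ∩ cyl F) = cyl F ∩ A := by
      rw [hA, ← Set.inter_assoc, Set.inter_comm]
    rw [e1, Set.inter_comm A' (cyl F)]
    by_cases hz : μ A' = 0
    · rw [measure_mono_null (Set.inter_subset_right.trans Set.inter_subset_right) hz,
        measure_mono_null Set.inter_subset_right hz, mul_zero]
    · exact (ENNReal.mul_right_inj hz (measure_ne_top _ _)).1 main
  · intro f hf
    have := List.IsSuffix.length_le hf
    simpa [FreeGroup.norm, toWord_gen] using this
  · intro f hf hne
    have hf' : [t] <:+ f.toWord := hf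
    rcases hw : f.toWord with _ | ⟨c, L⟩
    · rw [hw] at hf'
      simp at hf'
    · obtain ⟨h1, h2⟩ := exists_decomp f c L hw
      refine ⟨c, FreeGroup.mk L, ?_, h1, ?_⟩
      · show [t] <:+ (FreeGroup.mk L).toWord
        rw [hw, List.suffix_cons_iff] at hf'
        rw [h2]
        rcases hf' with h | h
        · exfalso
          apply hne
          apply FreeGroup.toWord_injective
          rw [hw, ← h, toWord_gen]
        · exact h
      · rw [← h1, FreeGroup.norm, FreeGroup.norm, hw, h2]; rfl
  · intro k'
    simp only [Measure.smul_apply, smul_eq_mul, Measure.restrict_apply (meas_pt _ _)]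
    by_cases hk : k' = k₀
    · subst hk
      rw [Set.inter_eq_right.2 (Set.inter_subset_right : A ⊆ _), Set.inter_self, mul_comm]
    · have h0 : {x : FG r → K | x (gen t) = k'} ∩ A' = ∅ := by
        apply Set.eq_empty_of_forall_notMem
        rintro x ⟨h1, h2⟩
        exact hk (h1.symm.trans h2)
      have h0' : {x : FG r → K | x (gen t) = k'} ∩ A = ∅ := by
        apply Set.eq_empty_of_forall_notMem
        rintro x ⟨h1, h2⟩
        exact hk (h1.symm.trans h2.2)
      simp [h0, h0']
  · intro a g F' hg hn hp k1 k2
    have hh := rec_mu ts μ hμ a g (insert (1, k) (insert (gen t, k₀) F')) hn (by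
      intro p hp'
      simp only [Finset.mem_insert] at hp'
      rcases hp' with rfl | rfl | hp'
      · exact (hApast a g hg hn).1
      · exact (hApast a g hg hn).2
      · exact hp p hp') k1 k2
    rw [cyl_insert, cyl_insert, ← Set.inter_assoc {x : FG r → K | x 1 = k}, ← hA] at hh
    simp only [Measure.smul_apply, smul_eq_mul, Measure.restrict_apply' mA]
    rw [mul_left_comm]
    congr 1
    convert hh using 2
    · ext x; simp only [Set.mem_inter_iff]; tauto
    · congr 1; ext x; simp only [Set.mem_inter_iff]; tauto
  · intro a g F' hg hn hp k1 k2
    have hh := rec_mu ts μ hμ a g (insert (gen t, k₀) F') hn (by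
      intro p hp'
      simp only [Finset.mem_insert] at hp'
      rcases hp' with rfl | hp'
      · exact (hApast a g hg hn).2
      · exact hp p hp') k1 k2
    rw [cyl_insert, ← hA'] at hh
    simp only [Measure.smul_apply, smul_eq_mul, Measure.restrict_apply' mA']
    rw [mul_left_comm]
    congr 1
    convert hh using 2
    · ext x; simp only [Set.mem_inter_iff]; tauto
    · congr 1; ext x; simp only [Set.mem_inter_iff]; tauto

lemma meas_shift (g : FG r) : Measurable (shiftT g : (FG r → K) → (FG r → K)) :=
  measurable_pi_lambda _ fun f => measurable_pi_apply (f * g)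

open Classical in
lemma gen_inv_cyl (ts : TransSys r K) (hts : ts.IsInvariant) (μ : Measure (FG r → K))
    [IsProbabilityMeasure μ]
    (hμ : IsInducedBy μ ts) (t : Fin r × Bool) (F : Finset (FG r × K)) :
    (μ.map (shiftT (gen t))) (cyl F) = μ (cyl F) := by
  refine uniq _ μ
    (fun s k₀ k => ENNReal.ofReal (ts.P s k₀ k)) 1 Set.univ ?_ ?_ ?_ ?_ ?_
    _ F rfl (by simp)
  · intro f _; simp
  · intro f _ hne
    rcases hw : f.toWord with _ | ⟨c, L⟩
    · exact absurd (FreeGroup.toWord_eq_nil_iff.1 hw) hne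
    · obtain ⟨h1, h2⟩ := exists_decomp f c L hw
      refine ⟨c, FreeGroup.mk L, trivial, h1, ?_⟩
      rw [← h1, FreeGroup.norm, FreeGroup.norm, hw, h2]; rfl
  · intro k
    rw [Measure.map_apply (meas_shift _) (meas_pt _ _), hμ.1, ← marg_mu ts hts μ hμ t k]
    congr 1
    ext x
    simp [shiftT]
  · intro s g F' _ hn hp k k₀
    have mE := (meas_pt g k₀).inter (meas_cyl F')
    rw [Measure.map_apply (meas_shift _) mE,
      Measure.map_apply (meas_shift _) ((meas_pt (gen s * g) k).inter mE)]
    let F'' : Finset (FG r × K) := F'.image (fun p => (p.1 * gen t, p.2))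
    have e1 : (shiftT (gen t)) ⁻¹' ({x : FG r → K | x g = k₀} ∩ cyl F') =
        {x | x (g * gen t) = k₀} ∩ cyl F'' := by
      ext x
      simp only [F'', cyl, shiftT, Set.mem_preimage, Set.mem_inter_iff, Set.mem_setOf_eq,
        Finset.forall_mem_image]
    have e2 : (shiftT (gen t)) ⁻¹' ({x : FG r → K | x (gen s * g) = k} ∩
        ({x : FG r → K | x g = k₀} ∩ cyl F')) =
        {x | x (gen s * (g * gen t)) = k} ∩ ({x | x (g * gen t) = k₀} ∩ cyl F'') := by
      rw [Set.preimage_inter, e1, ← mul_assoc]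
      rfl
    have hp' : ∀ p ∈ F'', p.1 ∈ Past (gen s * (g * gen t)) (g * gen t) := by
      intro p hp'
      obtain ⟨q, hq, rfl⟩ := Finset.mem_image.1 hp'
      rw [← mul_assoc]
      exact past_mul _ _ _ _ (hp q hq)
    rw [e1, e2]
    by_cases hn' : FreeGroup.norm (gen s * (g * gen t)) = FreeGroup.norm (g * gen t) + 1
    · exact rec_mu ts μ hμ s _ F'' hn' hp' k k₀
    · obtain ⟨rfl, ht⟩ := exceptional s t g hn hn'
      have e3 : gen s * (1 * gen t) = 1 := by rw [ht, gen_inv]; group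
      rw [e3] at hp' ⊢
      rw [one_mul] at hp' ⊢
      exact reverse_mu ts hts μ hμ s t ht k k₀ F''
        (fun p h => suffix_of_mem_past t _ p.1 rfl (hp' p h))
  · intro s g F' _ hn hp k k₀
    exact rec_mu ts μ hμ s g F' hn hp k k₀

open Classical in
lemma ext_cyl (m1 m2 : Measure (FG r → K)) [IsFiniteMeasure m1]
    (h : ∀ F : Finset (FG r × K), m1 (cyl F) = m2 (cyl F)) : m1 = m2 := by
  refine ext_of_generate_finite (Set.range (cyl (r := r) (K := K))) ?_ ?_ ?_ ?_
  · apply le_antisymm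
    · refine iSup_le fun g => ?_
      rintro _ ⟨S, -, rfl⟩
      have : (fun x : FG r → K => x g) ⁻¹' S = ⋃ k ∈ S, cyl {(g, k)} := by
        ext x; simp [cyl]
      rw [this]
      exact MeasurableSet.biUnion (Set.to_countable S)
        (fun k _ => MeasurableSpace.measurableSet_generateFrom ⟨_, rfl⟩)
    · apply MeasurableSpace.generateFrom_le
      rintro _ ⟨F, rfl⟩
      exact meas_cyl F
  · rintro _ ⟨F, rfl⟩ _ ⟨F', rfl⟩ _
    refine ⟨F ∪ F', ?_⟩
    ext x
    simp only [cyl, Set.mem_inter_iff, Set.mem_setOf_eq, Finset.mem_union]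
    constructor
    · intro h; exact ⟨fun p hp => h p (Or.inl hp), fun p hp => h p (Or.inr hp)⟩
    · rintro ⟨h1, h2⟩ p (hp | hp)
      · exact h1 p hp
      · exact h2 p hp
  · rintro _ ⟨F, rfl⟩
    exact h F
  · have : (Set.univ : Set (FG r → K)) = cyl ∅ := by ext x; simp [cyl]
    rw [this]; exact h _

end Helpers

/-- a measure induced by an invariant transition system is
invariant under the canonical shift action of the free group. -/
theorem stmt_12 {r : ℕ} (hr : 1 ≤ r) {K : Type*} [MeasurableSpace K]
    [DiscreteMeasurableSpace K] [Countable K]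
    (ts : TransSys r K) (hts : ts.IsInvariant)
    (μ : Measure (FG r → K)) [IsProbabilityMeasure μ] (hμ : IsInducedBy μ ts) :
    ∀ (g : FG r) (E : Set (FG r → K)), MeasurableSet E → μ (shiftT g ⁻¹' E) = μ E := by
  have hgen : ∀ t : Fin r × Bool, μ.map (shiftT (gen t)) = μ := by
    intro t
    haveI : IsProbabilityMeasure (μ.map (shiftT (gen t))) :=
      Measure.isProbabilityMeasure_map (meas_shift _).aemeasurable
    exact ext_cyl _ _ (gen_inv_cyl ts hts μ hμ t)
  have hall : ∀ (L : List (Fin r × Bool)) (g : FG r), g.toWord = L →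
      μ.map (shiftT g) = μ := by
    intro L
    induction L with
    | nil =>
      intro g hg
      rw [FreeGroup.toWord_eq_nil_iff.1 hg]
      have : (shiftT 1 : (FG r → K) → (FG r → K)) = id := by
        ext x f; simp [shiftT]
      rw [this, Measure.map_id]
    | cons c L ih =>
      intro g hg
      obtain ⟨h1, h2⟩ := exists_decomp g c L hg
      have : (shiftT g : (FG r → K) → (FG r → K)) =
          shiftT (gen c) ∘ shiftT (FreeGroup.mk L) := by
        ext x f; simp [shiftT, h1, mul_assoc]
      rw [this, ← Measure.map_map (meas_shift _) (meas_shift _), ih _ h2, hgen]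
  intro g E hE
  rw [← Measure.map_apply (meas_shift g) hE, hall _ g rfl]

end

end Bowen
end
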